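/- arXiv:1609.05443 — 2 statements merged into one kernel-verified Lean document; each statement's English description precedes it below -/
import Mathlib

section
/- Let 1/2 ≤ ν < 1 and let m > 0 satisfy ∫₀^m M_ν(u) du = 1/2. Then for every fixed x > 0, the median in time of the signaling Green function is located at t = (x/m)^{1/ν} = m^{−1/ν} x^{1/ν}, i.e. ∫₀^{(x/m)^{1/ν}} G_s(x,t;ν) dt = 1/2. -/
open Real MeasureTheory Set

/-- The Mainardi function `M_ν(x) = Σ_{n=0}^∞ (−x)^n/(n! · Γ(1 − ν − νn))`. -/
noncomputable def mainardi (ν x : ℝ) : ℝ :=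
  ∑' n : ℕ, (-x) ^ n / ((n.factorial : ℝ) * Real.Gamma (1 - ν - ν * n))

/-- The Green function of the signaling problem for the time-fractional
diffusion-wave equation: `G_s(x,t;ν) = (ν x / t^{ν+1}) · M_ν(x/t^ν)`. -/
noncomputable def greenSignaling (ν x t : ℝ) : ℝ :=
  (ν * x / t ^ (ν + 1)) * mainardi ν (x / t ^ ν)

lemma norm_cexp_neg_mul_ofReal (a : ℂ) (t : ℝ) : ‖Complex.exp (-(a * t))‖ = exp (-(a.re * t)) := by
  simp [Complex.norm_exp]

lemma integrableOn_rpow_mul_cexp {s : ℝ} (hs : 0 < s) {a : ℂ} (ha : 0 < a.re) :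
    IntegrableOn (fun t : ℝ ↦ ((t ^ (s - 1) : ℝ) : ℂ) * Complex.exp (-(a * t))) (Ioi 0) := by
  refine Integrable.mono' (integrableOn_rpow_mul_exp_neg_mul_rpow (s := s - 1) (by linarith)
    one_pos ha) (by fun_prop) ?_
  filter_upwards [ae_restrict_mem measurableSet_Ioi] with t ht
  rw [norm_mul, norm_cexp_neg_mul_ofReal, Complex.norm_real,
    norm_of_nonneg (rpow_nonneg (le_of_lt ht) _), rpow_one, neg_mul]

lemma hasDerivAt_integral_rpow_mul_cexp {s : ℝ} (hs : 0 < s) {a : ℂ} (ha : 0 < a.re) :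
    HasDerivAt (fun z : ℂ ↦ ∫ t in Ioi (0 : ℝ), ((t ^ (s - 1) : ℝ) : ℂ) * Complex.exp (-(z * t)))
      (∫ t in Ioi (0 : ℝ), ((t ^ (s - 1) : ℝ) : ℂ) * (Complex.exp (-(a * t)) * (-t))) a := by
  refine (hasDerivAt_integral_of_dominated_loc_of_deriv_le
    (F := fun (z : ℂ) (t : ℝ) ↦ ((t ^ (s - 1) : ℝ) : ℂ) * Complex.exp (-(z * t)))
    (F' := fun (z : ℂ) (t : ℝ) ↦ ((t ^ (s - 1) : ℝ) : ℂ) * (Complex.exp (-(z * t)) * (-t)))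
    (bound := fun t ↦ t ^ s * exp (-(a.re / 2) * t ^ (1 : ℝ)))
    (Metric.ball_mem_nhds a (half_pos ha)) (.of_forall fun z ↦ by fun_prop)
    (integrableOn_rpow_mul_cexp hs ha) (by fun_prop) ?_
    (integrableOn_rpow_mul_exp_neg_mul_rpow (by linarith) one_pos (half_pos ha)) ?_).2
  · filter_upwards [ae_restrict_mem measurableSet_Ioi] with t ht z hz
    have ht : 0 < t := ht
    have h1 : a.re / 2 ≤ z.re := by
      have := (Complex.abs_re_le_norm (z - a)).trans_lt (mem_ball_iff_norm.1 hz)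
      rw [Complex.sub_re, abs_lt] at this
      linarith
    rw [norm_mul, norm_mul, norm_cexp_neg_mul_ofReal, norm_neg, Complex.norm_real,
      Complex.norm_real, norm_of_nonneg ht.le, norm_of_nonneg (rpow_nonneg ht.le _), rpow_one]
    have h2 : t ^ s = t ^ (s - 1) * t := by rw [rpow_sub_one ht.ne']; field_simp
    rw [h2, mul_comm (exp _) t, ← mul_assoc]
    gcongr
    nlinarith
  · refine .of_forall fun t z _ ↦ HasDerivAt.const_mul _ ?_
    simpa using ((hasDerivAt_id z).mul_const (t : ℂ)).fun_neg.cexp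

/-- The Gamma integral rescaled by a complex number with positive real part. -/
lemma integral_rpow_mul_cexp {s : ℝ} (hs : 0 < s) {a : ℂ} (ha : 0 < a.re) :
    ∫ t in Ioi (0 : ℝ), ((t ^ (s - 1) : ℝ) : ℂ) * Complex.exp (-(a * t)) =
      (1 / a) ^ (s : ℂ) * Complex.Gamma s := by
  have hU : IsOpen {z : ℂ | 0 < z.re} := isOpen_lt continuous_const Complex.continuous_re
  have hf : AnalyticOnNhd ℂ (fun z : ℂ ↦ ∫ t in Ioi (0 : ℝ),
      ((t ^ (s - 1) : ℝ) : ℂ) * Complex.exp (-(z * t))) {z : ℂ | 0 < z.re} :=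
    DifferentiableOn.analyticOnNhd (fun z hz ↦
      (hasDerivAt_integral_rpow_mul_cexp hs hz).differentiableAt.differentiableWithinAt) hU
  have hg : AnalyticOnNhd ℂ (fun z : ℂ ↦ (1 / z) ^ (s : ℂ) * Complex.Gamma s) {z : ℂ | 0 < z.re} := by
    refine DifferentiableOn.analyticOnNhd (fun z (hz : 0 < z.re) ↦ ?_) hU
    have hz0 : z ≠ 0 := by rintro rfl; simp at hz
    refine (DifferentiableAt.mul_const ?_ _).differentiableWithinAt
    simp only [one_div]
    refine DifferentiableAt.cpow (differentiableAt_inv hz0) (by fun_prop) (Or.inl ?_)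
    rw [Complex.inv_re]
    exact div_pos hz (Complex.normSq_pos.2 hz0)
  refine hf.eqOn_of_preconnected_of_frequently_eq hg
    (convex_halfSpace_re_gt 0).isPreconnected (z₀ := 1) (by simp) ?_ ha
  have hin : Filter.Tendsto (fun x : ℝ ↦ (x : ℂ)) (nhdsWithin 1 {1}ᶜ) (nhdsWithin 1 {1}ᶜ) := by
    refine tendsto_nhdsWithin_iff.2 ⟨?_, ?_⟩
    · have : Filter.Tendsto (fun x : ℝ ↦ (x : ℂ)) (nhds 1) (nhds ((1 : ℝ) : ℂ)) :=
        Complex.continuous_ofReal.tendsto 1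
      simpa using this.mono_left nhdsWithin_le_nhds
    · filter_upwards [self_mem_nhdsWithin] with x hx
      simpa using hx
  refine hin.frequently (Filter.Eventually.frequently ?_)
  filter_upwards [nhdsWithin_le_nhds (lt_mem_nhds (zero_lt_one' ℝ))] with x hx
  rw [← Complex.integral_cpow_mul_exp_neg_mul_Ioi (by simpa using hs) hx]
  refine setIntegral_congr_fun measurableSet_Ioi fun t ht ↦ ?_
  simp only [Complex.ofReal_cpow (le_of_lt ht)]
  simp

lemma abs_im_cexp_neg_mul_ofReal_le (a : ℂ) {t : ℝ} (ht : 0 ≤ t) :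
    |(Complex.exp (-(a * t))).im| ≤ exp (-(a.re * t)) * (|a.im| * t) := by
  have h : (Complex.exp (-(a * t))).im = exp (-(a.re * t)) * sin (-(a.im * t)) := by
    simp [Complex.exp_im]
  rw [h, abs_mul, abs_of_pos (exp_pos _)]
  gcongr
  calc |sin (-(a.im * t))| ≤ |-(a.im * t)| := abs_sin_le_abs
    _ = |a.im| * t := by rw [abs_neg, abs_mul, abs_of_nonneg ht]

lemma integrableOn_exp_neg_mul {c : ℝ} (hc : 0 < c) (m : ℝ) :
    IntegrableOn (fun t : ℝ ↦ exp (-(c * t))) (Ioi m) := by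
  simpa [neg_mul] using integrableOn_exp_mul_Ioi (neg_lt_zero.2 hc) m

lemma integrableOn_im_cexp_div {a : ℂ} (ha : 0 < a.re) :
    IntegrableOn (fun t : ℝ ↦ (Complex.exp (-(a * t))).im / t) (Ioi 0) := by
  refine Integrable.mono' ((integrableOn_exp_neg_mul ha 0).mul_const |a.im|)
    (Measurable.aestronglyMeasurable (by fun_prop)) ?_
  filter_upwards [ae_restrict_mem measurableSet_Ioi] with t (ht : 0 < t)
  rw [norm_div, norm_of_nonneg ht.le, div_le_iff₀ ht, mul_assoc]
  exact abs_im_cexp_neg_mul_ofReal_le a ht.le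

lemma tendsto_im_inv_cpow_mul_Gamma {a : ℂ} (ha : 0 < a.re) :
    Filter.Tendsto (fun s : ℝ ↦ ((1 / a) ^ (s : ℂ) * Complex.Gamma s).im) (nhdsWithin 0 (Ioi 0))
      (nhds (-a.arg)) := by
  have ha0 : a ≠ 0 := by rintro rfl; simp at ha
  have hlog : (Complex.log (1 / a)).im = -a.arg := by
    rw [one_div, Complex.log_inv, Complex.neg_im, Complex.log_im]
    intro h
    have := (Complex.arg_eq_pi_iff.1 h).1
    linarith
  have hin : Filter.Tendsto (fun s : ℝ ↦ (s : ℂ)) (nhdsWithin 0 (Ioi 0)) (nhdsWithin 0 {0}ᶜ) := by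
    refine tendsto_nhdsWithin_iff.2 ⟨?_, ?_⟩
    · have : Filter.Tendsto (fun s : ℝ ↦ (s : ℂ)) (nhds 0) (nhds ((0 : ℝ) : ℂ)) :=
        Complex.continuous_ofReal.tendsto 0
      simpa using this.mono_left nhdsWithin_le_nhds
    · filter_upwards [self_mem_nhdsWithin] with s (hs : 0 < s)
      simpa using hs.ne'
  have hder : HasDerivAt (fun z : ℂ ↦ (1 / a) ^ z) (Complex.log (1 / a)) 0 := by
    simpa using (hasDerivAt_id (0 : ℂ)).const_cpow (c := 1 / a) (Or.inl (by simpa using ha0))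
  have h1 := (hasDerivAt_iff_tendsto_slope.1 hder).comp hin
  have h2 := Complex.tendsto_self_mul_Gamma_nhds_zero.comp hin
  have h3 := (Complex.continuous_im.tendsto _).comp (h1.mul h2)
  rw [mul_one, hlog] at h3
  refine h3.congr' ?_
  filter_upwards [self_mem_nhdsWithin] with s (hs : 0 < s)
  have hs' : (s : ℂ) ≠ 0 := by simpa using hs.ne'
  have : slope (fun z : ℂ ↦ (1 / a) ^ z) 0 s * (s * Complex.Gamma s) =
      (1 / a) ^ (s : ℂ) * Complex.Gamma s - Real.Gamma s := by
    rw [slope_def_field, ← Complex.Gamma_ofReal]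
    simp only [Complex.cpow_zero, sub_zero]
    field_simp
  simp only [Function.comp_apply, this, Complex.sub_im, Complex.ofReal_im, sub_zero]

lemma integral_im_cexp_div {a : ℂ} (ha : 0 < a.re) :
    ∫ t in Ioi (0 : ℝ), (Complex.exp (-(a * t))).im / t = -a.arg := by
  have hbound : IntegrableOn (fun t : ℝ ↦ |a.im| * (exp (-(a.re * t)) + t * exp (-(a.re * t))))
      (Ioi 0) := by
    refine ((integrableOn_exp_neg_mul ha 0).add ?_).const_mul _
    simpa [neg_mul] using
      integrableOn_rpow_mul_exp_neg_mul_rpow (s := 1) (p := 1) (b := a.re) (by norm_num)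
        one_pos ha
  have hlim : Filter.Tendsto
      (fun s : ℝ ↦ ∫ t in Ioi (0 : ℝ), t ^ (s - 1) * (Complex.exp (-(a * t))).im)
      (nhdsWithin 0 (Ioi 0)) (nhds (∫ t in Ioi (0 : ℝ), (Complex.exp (-(a * t))).im / t)) := by
    refine tendsto_integral_filter_of_dominated_convergence _ (.of_forall fun s ↦ by fun_prop) ?_
      hbound ?_
    · filter_upwards [Ioo_mem_nhdsGT one_pos] with s hs
      filter_upwards [ae_restrict_mem measurableSet_Ioi] with t (ht : 0 < t)
      have h1 : t ^ s ≤ 1 + t := by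
        rcases le_total t 1 with h | h
        · linarith [rpow_le_one ht.le h hs.1.le]
        · have := rpow_le_rpow_of_exponent_le h hs.2.le
          rw [rpow_one] at this
          linarith
      rw [norm_mul, norm_of_nonneg (rpow_nonneg ht.le _)]
      calc t ^ (s - 1) * ‖(Complex.exp (-(a * t))).im‖
          ≤ t ^ (s - 1) * (exp (-(a.re * t)) * (|a.im| * t)) := by
            gcongr
            exact abs_im_cexp_neg_mul_ofReal_le a ht.le
        _ = |a.im| * exp (-(a.re * t)) * t ^ s := by
            rw [rpow_sub_one ht.ne']
            field_simp
        _ ≤ |a.im| * exp (-(a.re * t)) * (1 + t) := by gcongr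
        _ = _ := by ring
    · filter_upwards [ae_restrict_mem measurableSet_Ioi] with t (ht : 0 < t)
      have : Filter.Tendsto (fun s : ℝ ↦ t ^ (s - 1)) (nhdsWithin 0 (Ioi 0)) (nhds (t ^ (0 - 1 : ℝ))) := by
        refine Filter.Tendsto.mono_left (Continuous.tendsto ?_ 0) nhdsWithin_le_nhds
        exact (continuous_const_rpow ht.ne').comp (continuous_id.sub continuous_const)
      rw [zero_sub, rpow_neg_one] at this
      simpa [div_eq_inv_mul] using this.mul_const (Complex.exp (-(a * t))).im
  refine tendsto_nhds_unique hlim ((tendsto_im_inv_cpow_mul_Gamma ha).congr' ?_)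
  filter_upwards [self_mem_nhdsWithin] with s (hs : 0 < s)
  rw [← integral_rpow_mul_cexp hs ha]
  refine (integral_im (integrableOn_rpow_mul_cexp hs ha)).symm.trans
    (integral_congr_ae (.of_forall fun t ↦ ?_))
  exact Complex.im_ofReal_mul _ _

lemma integral_im_cexp_rpow_div {a : ℂ} (ha : 0 < a.re) {p : ℝ} (hp : 0 < p) :
    IntegrableOn (fun t : ℝ ↦ (Complex.exp (-(a * ((t ^ p : ℝ) : ℂ)))).im / t) (Ioi 0) ∧
    p * ∫ t in Ioi (0 : ℝ), (Complex.exp (-(a * ((t ^ p : ℝ) : ℂ)))).im / t = -a.arg := by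
  have key : EqOn (fun t : ℝ ↦ (|p| * t ^ (p - 1)) •
        ((Complex.exp (-(a * ((t ^ p : ℝ) : ℂ)))).im / t ^ p))
      (fun t ↦ p * ((Complex.exp (-(a * ((t ^ p : ℝ) : ℂ)))).im / t)) (Ioi 0) := by
    intro t ht
    have ht : 0 < t := ht
    have := rpow_pos_of_pos ht p
    simp only [smul_eq_mul, abs_of_pos hp, rpow_sub_one ht.ne']
    field_simp
  constructor
  · have := (integrableOn_Ioi_comp_rpow_iff _ hp.ne').2 (integrableOn_im_cexp_div ha)
    rw [integrableOn_congr_fun key measurableSet_Ioi] at this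
    simpa [hp.ne', IntegrableOn, integrable_const_mul_iff] using this
  · rw [← integral_const_mul, ← setIntegral_congr_fun measurableSet_Ioi key,
      integral_comp_rpow_Ioi (fun t : ℝ ↦ (Complex.exp (-(a * t))).im / t) hp.ne',
      integral_im_cexp_div ha]

lemma integral_pow_mul_cexp_neg_rpow {a : ℂ} (ha : 0 < a.re) {p : ℝ} (hp : 0 < p) (n : ℕ) :
    p * ∫ t in Ioi (0 : ℝ), (t : ℂ) ^ n * Complex.exp (-(a * ((t ^ p : ℝ) : ℂ))) =
      (1 / a) ^ ((((n + 1) / p : ℝ)) : ℂ) * Complex.Gamma ((((n + 1) / p : ℝ)) : ℂ) := by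
  set s : ℝ := (n + 1) / p with hs
  have hs0 : 0 < s := by positivity
  rw [← integral_rpow_mul_cexp hs0 ha, ← integral_const_mul, ← integral_comp_rpow_Ioi
    (fun t : ℝ ↦ ((t ^ (s - 1) : ℝ) : ℂ) * Complex.exp (-(a * t))) hp.ne']
  refine setIntegral_congr_fun measurableSet_Ioi fun t ht ↦ ?_
  have ht : 0 < t := ht
  have h2 : t ^ (p - 1) * (t ^ p) ^ (s - 1) = t ^ n := by
    rw [← rpow_mul ht.le, ← rpow_add ht, ← rpow_natCast]
    congr 1
    rw [hs]; field_simp; ring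
  simp only [abs_of_pos hp, Complex.real_smul]
  rw [← Complex.ofReal_pow, ← h2]
  push_cast
  ring

lemma integrableOn_exp_mul_exp_neg_rpow (k : ℝ) {c p : ℝ} (hc : 0 < c) (hp : 1 < p) :
    IntegrableOn (fun t : ℝ ↦ exp (-(c * t ^ p)) * exp (k * t)) (Ioi 0) := by
  refine integrable_of_isBigO_exp_neg one_pos ?_ (Asymptotics.IsBigO.of_bound 1 ?_)
  · have : Continuous fun t : ℝ ↦ t ^ p := continuous_rpow_const (by linarith)
    fun_prop
  · have h := (tendsto_rpow_atTop (sub_pos.2 hp)).const_mul_atTop hc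
    filter_upwards [h.eventually_ge_atTop (k + 1), Filter.eventually_gt_atTop 0] with t ht ht0
    rw [← exp_add, norm_of_nonneg (exp_pos _).le, norm_of_nonneg (exp_pos _).le, one_mul, exp_le_exp]
    rw [rpow_sub_one ht0.ne', mul_div_assoc', le_div_iff₀ ht0] at ht
    linarith

lemma hasSum_integral_cexp_mul_pow {a : ℂ} (ha : 0 < a.re) (b : ℂ) {p : ℝ} (hp : 1 < p) (x : ℝ) :
    HasSum (fun n : ℕ ↦ ∫ t in Ioi (0 : ℝ), b * Complex.exp (-(a * ((t ^ p : ℝ) : ℂ))) *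
        ((-(b * t) * x) ^ n / n.factorial))
      (∫ t in Ioi (0 : ℝ), b * Complex.exp (-(a * ((t ^ p : ℝ) : ℂ))) *
        Complex.exp (-(b * t) * x)) := by
  have hsum (t : ℝ) := (NormedSpace.expSeries_div_hasSum_exp (‖b‖ * |x| * t)).mul_left
    (‖b‖ * exp (-(a.re * t ^ p)))
  simp only [← congrFun Real.exp_eq_exp_ℝ] at hsum
  refine hasSum_integral_of_dominated_convergence
    (fun n t ↦ ‖b‖ * exp (-(a.re * t ^ p)) * ((‖b‖ * |x| * t) ^ n / n.factorial))
    (fun n ↦ by fun_prop) (fun n ↦ ?_) (.of_forall fun t ↦ (hsum t).summable) ?_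
    (.of_forall fun t ↦ ?_)
  · filter_upwards [ae_restrict_mem measurableSet_Ioi] with t ht
    have ht : 0 < t := ht
    simp only [norm_mul, norm_div, norm_pow, norm_cexp_neg_mul_ofReal, norm_neg, Complex.norm_real,
      norm_of_nonneg ht.le, Complex.norm_natCast, norm_eq_abs x]
    rw [mul_right_comm ‖b‖ t]
  · simp only [fun t ↦ (hsum t).tsum_eq]
    simpa only [mul_assoc] using
      (integrableOn_exp_mul_exp_neg_rpow (‖b‖ * |x|) ha hp).const_mul ‖b‖
  · refine HasSum.mul_left _ ?_
    rw [Complex.exp_eq_exp_ℂ]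
    exact NormedSpace.expSeries_div_hasSum_exp _

lemma inv_Gamma_one_sub {s : ℝ} (hs : 0 < s) :
    (Real.Gamma (1 - s))⁻¹ = Real.Gamma s * sin (π * s) / π := by
  have h := Real.Gamma_mul_Gamma_one_sub s
  have hG := (Real.Gamma_pos_of_pos hs).ne'
  rcases eq_or_ne (sin (π * s)) 0 with h0 | h0
  · rw [h0, div_zero, mul_eq_zero, or_iff_right hG] at h
    simp [h, h0]
  · have hne : Real.Gamma (1 - s) ≠ 0 := by
      rintro h1
      rw [h1, mul_zero] at h
      exact div_ne_zero pi_ne_zero h0 h.symm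
    rw [eq_div_iff h0] at h
    refine inv_eq_of_mul_eq_one_right ?_
    rw [← mul_div_assoc, ← mul_assoc, mul_comm (Real.Gamma (1 - s)), h, div_self pi_ne_zero]

lemma mainardi_eq_im_integral {ν θ : ℝ} (hν0 : 0 < ν) (hν1 : ν < 1) (hθ0 : π / 2 < θ) (hθ1 : θ < π)
    (x : ℝ) :
    mainardi ν x = ν⁻¹ / π * (∫ t in Ioi (0 : ℝ), Complex.exp ((ν * θ : ℝ) * Complex.I) *
      Complex.exp (-(Complex.exp ((θ - π : ℝ) * Complex.I) * ((t ^ ν⁻¹ : ℝ) : ℂ))) *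
        Complex.exp (-(Complex.exp ((ν * θ : ℝ) * Complex.I) * t) * x)).im := by
  set a := Complex.exp ((θ - π : ℝ) * Complex.I) with ha_def
  set b := Complex.exp ((ν * θ : ℝ) * Complex.I) with hb_def
  have ha : 0 < a.re := by
    rw [ha_def, Complex.exp_ofReal_mul_I_re]
    exact cos_pos_of_mem_Ioo ⟨by linarith, by linarith [pi_pos]⟩
  have hp : 1 < ν⁻¹ := (one_lt_inv₀ hν0).2 hν1
  have hp0 : 0 < ν⁻¹ := by linarith
  have h := (Complex.hasSum_im (hasSum_integral_cexp_mul_pow ha b hp x)).mul_left (ν⁻¹ / π)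
  rw [← h.tsum_eq, mainardi]
  congr 1 with n
  set s : ℝ := (n + 1) / ν⁻¹ with hs
  have hs0 : 0 < s := by positivity
  have hsν : s = ν * (n + 1) := by rw [hs]; field_simp
  have hmom := integral_pow_mul_cexp_neg_rpow ha hp0 n
  rw [← hs] at hmom
  have hterm : (∫ t in Ioi (0 : ℝ), b * Complex.exp (-(a * ((t ^ ν⁻¹ : ℝ) : ℂ))) *
        ((-(b * t) * x) ^ n / n.factorial)) =
      (((-x) ^ n / n.factorial : ℝ) : ℂ) * (b ^ (n + 1) *
        ∫ t in Ioi (0 : ℝ), (t : ℂ) ^ n * Complex.exp (-(a * ((t ^ ν⁻¹ : ℝ) : ℂ)))) := by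
    rw [← integral_const_mul, ← integral_const_mul]
    congr 1 with t
    rw [show -(b * t) * x = b * t * (-x) by ring, mul_pow, mul_pow]
    push_cast
    ring
  have hpow : b ^ (n + 1) * (1 / a) ^ (s : ℂ) = Complex.exp ((π * s : ℝ) * Complex.I) := by
    have h1 : 1 / a = Complex.exp ((π - θ : ℝ) * Complex.I) := by
      rw [ha_def, one_div, ← Complex.exp_neg]
      congr 1; push_cast; ring
    have h2 : Complex.log (Complex.exp ((π - θ : ℝ) * Complex.I)) = (π - θ : ℝ) * Complex.I := by
      refine Complex.log_exp ?_ ?_ <;> simp <;> linarith [pi_pos]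
    rw [h1, Complex.cpow_def_of_ne_zero (Complex.exp_ne_zero _), h2, hb_def, ← Complex.exp_nat_mul,
      ← Complex.exp_add, hsν]
    congr 1; push_cast; ring
  have him : (((ν⁻¹ : ℝ) : ℂ) * (b ^ (n + 1) *
      ∫ t in Ioi (0 : ℝ), (t : ℂ) ^ n * Complex.exp (-(a * ((t ^ ν⁻¹ : ℝ) : ℂ))))) =
      ((Real.Gamma s : ℝ) : ℂ) * Complex.exp ((π * s : ℝ) * Complex.I) := by
    rw [← hpow, ← Complex.Gamma_ofReal, mul_left_comm, hmom]
    ring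
  have him2 := congrArg Complex.im him
  rw [Complex.im_ofReal_mul, Complex.im_ofReal_mul,
    Complex.exp_ofReal_mul_I_im] at him2
  rw [hterm, Complex.im_ofReal_mul, show 1 - ν - ν * n = 1 - s by rw [hsν]; ring, ← div_div,
    div_eq_mul_inv _ (Real.Gamma _), inv_Gamma_one_sub hs0, ← him2]
  ring

lemma integral_integral_cexp_Ioi {b : ℂ} (hb : 0 < b.re) {h : ℝ → ℂ} (hh : Measurable h) (m : ℝ)
    (hint : IntegrableOn (fun t : ℝ ↦ h t * Complex.exp (-(b * t) * m) / t) (Ioi 0)) :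
    IntegrableOn (fun x : ℝ ↦ ∫ t in Ioi (0 : ℝ), b * h t * Complex.exp (-(b * t) * x)) (Ioi m) ∧
    ∫ x in Ioi m, ∫ t in Ioi (0 : ℝ), b * h t * Complex.exp (-(b * t) * x) =
      ∫ t in Ioi (0 : ℝ), h t * Complex.exp (-(b * t) * m) / t := by
  have hre {t : ℝ} (ht : 0 < t) : (-(b * t)).re < 0 := by simpa using mul_pos hb ht
  have hprod : Integrable (Function.uncurry fun x t : ℝ ↦ b * h t * Complex.exp (-(b * t) * x))
      ((volume.restrict (Ioi m)).prod (volume.restrict (Ioi 0))) := by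
    refine (integrable_prod_iff' (Measurable.aestronglyMeasurable (by fun_prop))).2 ⟨?_, ?_⟩
    · filter_upwards [ae_restrict_mem measurableSet_Ioi] with t ht
      exact (integrableOn_exp_mul_complex_Ioi (hre ht) m).const_mul (b * h t)
    · refine (hint.norm.const_mul (‖b‖ / b.re)).congr ?_
      filter_upwards [ae_restrict_mem measurableSet_Ioi] with t ht
      have ht : 0 < t := ht
      have hexp (x : ℝ) : ‖Complex.exp (-(b * t) * x)‖ = exp (-(b.re * t) * x) := by
        simp [Complex.norm_exp]
      simp only [Function.uncurry_apply_pair, norm_mul, norm_div, hexp, Complex.norm_real,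
        norm_of_nonneg ht.le]
      rw [integral_const_mul, integral_exp_mul_Ioi (by simpa using hre ht)]
      field_simp
  refine ⟨hprod.integral_prod_left, (integral_integral_swap hprod).trans ?_⟩
  refine setIntegral_congr_fun measurableSet_Ioi fun t ht ↦ ?_
  have hb0 : b ≠ 0 := by rintro rfl; simp at hb
  have ht0 : (t : ℂ) ≠ 0 := by simpa using (ne_of_gt ht : t ≠ 0)
  rw [integral_const_mul, integral_exp_mul_complex_Ioi (hre ht)]
  field_simp

lemma integral_integral_cexp_interval {b : ℂ} (hb : 0 < b.re) {h : ℝ → ℂ}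
    (hint : IntegrableOn h (Ioi 0)) {m : ℝ} (hm : 0 ≤ m) :
    IntegrableOn (fun x : ℝ ↦ ∫ t in Ioi (0 : ℝ), b * h t * Complex.exp (-(b * t) * x)) (Ioc 0 m) ∧
    IntegrableOn (fun t : ℝ ↦ h t * (1 - Complex.exp (-(b * t) * m)) / t) (Ioi 0) ∧
    ∫ x in Ioc 0 m, ∫ t in Ioi (0 : ℝ), b * h t * Complex.exp (-(b * t) * x) =
      ∫ t in Ioi (0 : ℝ), h t * (1 - Complex.exp (-(b * t) * m)) / t := by
  have hbound : Integrable (fun z : ℝ × ℝ ↦ (b : ℂ) * h z.2)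
      ((volume.restrict (Ioc 0 m)).prod (volume.restrict (Ioi 0))) :=
    (integrable_const b).mul_prod hint
  have hprod : Integrable (Function.uncurry fun x t : ℝ ↦ b * h t * Complex.exp (-(b * t) * x))
      ((volume.restrict (Ioc 0 m)).prod (volume.restrict (Ioi 0))) := by
    refine hbound.mono (hbound.1.mul (by fun_prop)) ?_
    rw [Measure.prod_restrict]
    filter_upwards [ae_restrict_mem (measurableSet_Ioc.prod measurableSet_Ioi)] with ⟨x, t⟩ hxt
    obtain ⟨hx, ht⟩ : x ∈ Ioc 0 m ∧ t ∈ Ioi 0 := hxt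
    have hx : 0 < x := hx.1
    have ht : 0 < t := ht
    rw [Function.uncurry_apply_pair, norm_mul]
    refine mul_le_of_le_one_right (norm_nonneg _) ?_
    have : 0 ≤ b.re * t * x := by positivity
    simpa [Complex.norm_exp] using this
  have hinner : EqOn (fun t : ℝ ↦ ∫ x in Ioc 0 m, b * h t * Complex.exp (-(b * t) * x))
      (fun t ↦ h t * (1 - Complex.exp (-(b * t) * m)) / t) (Ioi 0) := by
    intro t ht
    have hb0 : b ≠ 0 := by rintro rfl; simp at hb
    have ht0 : (t : ℂ) ≠ 0 := by simpa using (ne_of_gt ht : t ≠ 0)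
    simp only
    rw [integral_const_mul, ← intervalIntegral.integral_of_le hm,
      integral_exp_mul_complex (neg_ne_zero.2 (mul_ne_zero hb0 ht0))]
    simp only [Complex.ofReal_zero, mul_zero, Complex.exp_zero]
    field_simp
    ring
  refine ⟨hprod.integral_prod_left, ?_, (integral_integral_swap hprod).trans
    (setIntegral_congr_fun measurableSet_Ioi hinner)⟩
  exact (integrableOn_congr_fun hinner measurableSet_Ioi).1 hprod.integral_prod_right

lemma norm_cexp_neg_sub_one_le {z : ℂ} (hz : 0 ≤ z.re) : ‖Complex.exp (-z) - 1‖ ≤ 2 * ‖z‖ := by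
  rcases le_total ‖z‖ 1 with h | h
  · simpa using Complex.norm_exp_sub_one_le (x := -z) (by simpa using h)
  · have : ‖Complex.exp (-z)‖ ≤ 1 := by simpa [Complex.norm_exp] using hz
    calc ‖Complex.exp (-z) - 1‖ ≤ ‖Complex.exp (-z)‖ + ‖(1 : ℂ)‖ := norm_sub_le _ _
      _ ≤ 2 * ‖z‖ := by rw [norm_one]; linarith

lemma integrableOn_cexp_neg_rpow {a : ℂ} (ha : 0 < a.re) {p : ℝ} (hp : 1 < p) :
    IntegrableOn (fun t : ℝ ↦ Complex.exp (-(a * ((t ^ p : ℝ) : ℂ)))) (Ioi 0) := by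
  refine Integrable.mono' (integrableOn_exp_mul_exp_neg_rpow 0 ha hp) (by fun_prop)
    (.of_forall fun t ↦ ?_)
  simp [norm_cexp_neg_mul_ofReal]

lemma integrableOn_cexp_neg_rpow_sub_one_mul {a b : ℂ} (ha : 0 < a.re) (hb : 0 < b.re) {p m : ℝ}
    (hp : 0 < p) (hm : 0 < m) :
    IntegrableOn (fun t : ℝ ↦ (Complex.exp (-(a * ((t ^ p : ℝ) : ℂ))) - 1) *
      Complex.exp (-(b * t) * m) / t) (Ioi 0) := by
  refine Integrable.mono' ((integrableOn_rpow_mul_exp_neg_mul_rpow (s := p - 1) (by linarith)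
    one_pos (mul_pos hb hm)).const_mul (2 * ‖a‖)) (Measurable.aestronglyMeasurable (by fun_prop)) ?_
  filter_upwards [ae_restrict_mem measurableSet_Ioi] with t ht
  have ht : 0 < t := ht
  have hpos : 0 ≤ t ^ p := rpow_nonneg ht.le p
  have h1 := norm_cexp_neg_sub_one_le (z := a * ((t ^ p : ℝ) : ℂ)) (by simp; positivity)
  have h2 : ‖Complex.exp (-(b * t) * m)‖ = exp (-(b.re * m) * t) := by
    simp [Complex.norm_exp]; ring
  rw [norm_mul, Complex.norm_real, norm_of_nonneg hpos] at h1
  rw [norm_div, norm_mul, h2, Complex.norm_real, norm_of_nonneg ht.le, rpow_one, rpow_sub_one ht.ne']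
  calc _ ≤ 2 * (‖a‖ * t ^ p) * exp (-(b.re * m) * t) / t := by gcongr
    _ = _ := by ring

/-- The Mainardi function has total mass one on `(0, ∞)`. -/
lemma integral_mainardi_add_integral_Ioi {ν : ℝ} (hν0 : 1 / 2 ≤ ν) (hν1 : ν < 1) {m : ℝ}
    (hm : 0 < m) : (∫ x in (0 : ℝ)..m, mainardi ν x) + ∫ x in Ioi m, mainardi ν x = 1 := by
  have hν : 0 < ν := by linarith
  have hp : 1 < ν⁻¹ := (one_lt_inv₀ hν).2 hν1
  have hp0 : 0 < ν⁻¹ := by linarith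
  obtain ⟨θ, hθ0, hθ⟩ : ∃ θ, π / 2 < θ ∧ θ < π / 2 / ν :=
    exists_between ((lt_div_iff₀ hν).2 (by nlinarith [pi_pos]))
  have hνθ : ν * θ < π / 2 := by rwa [lt_div_iff₀ hν, mul_comm] at hθ
  have hθ1 : θ < π := by nlinarith [pi_pos]
  have hM := mainardi_eq_im_integral hν hν1 hθ0 hθ1
  set a := Complex.exp ((θ - π : ℝ) * Complex.I) with ha_def
  set b := Complex.exp ((ν * θ : ℝ) * Complex.I) with hb_def
  have ha : 0 < a.re := by
    rw [ha_def, Complex.exp_ofReal_mul_I_re]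
    exact cos_pos_of_mem_Ioo ⟨by linarith, by linarith [pi_pos]⟩
  have hνθ0 : 0 < ν * θ := mul_pos hν (by linarith [pi_pos])
  have hb : 0 < b.re := by
    rw [hb_def, Complex.exp_ofReal_mul_I_re]
    exact cos_pos_of_mem_Ioo ⟨by linarith [pi_pos], hνθ⟩
  have harg {φ : ℝ} (h : φ ∈ Ioc (-π) π) : (Complex.exp (φ * Complex.I)).arg = φ := by
    rwa [Complex.arg_exp_mul_I, toIocMod_eq_self, show -π + 2 * π = π by ring]
  set E : ℝ → ℂ := fun t ↦ Complex.exp (-(a * ((t ^ ν⁻¹ : ℝ) : ℂ)))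
  have hE : IntegrableOn E (Ioi 0) := integrableOn_cexp_neg_rpow ha hp
  obtain ⟨hI1, hI2, hI3⟩ := integral_integral_cexp_interval hb hE hm.le
  have hJ0 : IntegrableOn (fun t : ℝ ↦ (E t - 1) * Complex.exp (-(b * t) * m) / t) (Ioi 0) :=
    integrableOn_cexp_neg_rpow_sub_one_mul ha hb hp0 hm
  obtain ⟨hJ1, hJ2⟩ := integral_integral_cexp_Ioi hb (h := fun t ↦ E t - 1) (by fun_prop) m hJ0
  have hIJ {x : ℝ} (hx : 0 < x) :
      (∫ t in Ioi (0 : ℝ), b * E t * Complex.exp (-(b * t) * x)).im =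
        (∫ t in Ioi (0 : ℝ), b * (E t - 1) * Complex.exp (-(b * t) * x)).im := by
    have hre : (-(b * x)).re < 0 := by simpa using mul_pos hb hx
    have hb0 : b ≠ 0 := Complex.exp_ne_zero _
    have hx0 : (x : ℂ) ≠ 0 := by simpa using hx.ne'
    have hswap (t : ℝ) : Complex.exp (-(b * t) * x) = Complex.exp (-(b * x) * t) := by
      congr 1; ring
    have hexp : IntegrableOn (fun t : ℝ ↦ b * Complex.exp (-(b * t) * x)) (Ioi 0) := by
      simp only [hswap]
      exact (integrableOn_exp_mul_complex_Ioi hre 0).const_mul b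
    have hval : ∫ t in Ioi (0 : ℝ), b * Complex.exp (-(b * t) * x) = ((x⁻¹ : ℝ) : ℂ) := by
      simp only [hswap]
      rw [integral_const_mul, integral_exp_mul_complex_Ioi hre]
      simp only [Complex.ofReal_zero, mul_zero, Complex.exp_zero, Complex.ofReal_inv]
      field_simp
    have hprod : IntegrableOn (fun t : ℝ ↦ b * E t * Complex.exp (-(b * t) * x)) (Ioi 0) := by
      refine Integrable.mono (hE.const_mul b) (by fun_prop) ?_
      filter_upwards [ae_restrict_mem measurableSet_Ioi] with t ht
      have ht : 0 < t := ht
      rw [norm_mul]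
      refine mul_le_of_le_one_right (norm_nonneg _) ?_
      have : 0 ≤ b.re * t * x := by positivity
      simpa [Complex.norm_exp] using this
    have hsplit : (fun t : ℝ ↦ b * (E t - 1) * Complex.exp (-(b * t) * x)) =
        fun t : ℝ ↦ b * E t * Complex.exp (-(b * t) * x) - b * Complex.exp (-(b * t) * x) := by
      funext t; ring
    rw [hsplit, integral_sub hprod hexp, hval, Complex.sub_im, Complex.ofReal_im, sub_zero]
  have h1 : ∫ x in (0 : ℝ)..m, mainardi ν x = ν⁻¹ / π *
      (∫ t in Ioi (0 : ℝ), E t * (1 - Complex.exp (-(b * t) * m)) / t).im := by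
    rw [intervalIntegral.integral_of_le hm.le, ← hI3]
    simp only [hM]
    rw [integral_const_mul]
    congr 1
    exact integral_im hI1
  have h2 : ∫ x in Ioi m, mainardi ν x = ν⁻¹ / π *
      (∫ t in Ioi (0 : ℝ), (E t - 1) * Complex.exp (-(b * t) * m) / t).im := by
    rw [← hJ2]
    simp only [hM]
    rw [integral_const_mul]
    congr 1
    refine (setIntegral_congr_fun measurableSet_Ioi fun x hx ↦ hIJ (hm.trans hx)).trans ?_
    exact integral_im hJ1
  have hmb : 0 < ((m : ℂ) * b).re := by simpa using mul_pos hm hb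
  obtain ⟨hA1, hA2⟩ := integral_im_cexp_rpow_div ha hp0
  have hB1 := integrableOn_im_cexp_div hmb
  have hB2 := integral_im_cexp_div hmb
  have hsum : (∫ t in Ioi (0 : ℝ), E t * (1 - Complex.exp (-(b * t) * m)) / t).im +
      (∫ t in Ioi (0 : ℝ), (E t - 1) * Complex.exp (-(b * t) * m) / t).im =
      (∫ t in Ioi (0 : ℝ), (E t).im / t) -
        ∫ t in Ioi (0 : ℝ), (Complex.exp (-(m * b * t))).im / t := by
    rw [← integral_sub hA1 hB1, ← Complex.add_im, ← integral_add hI2 hJ0]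
    refine (integral_im (hI2.add hJ0)).symm.trans (integral_congr_ae (.of_forall fun t ↦ ?_))
    simp only [Pi.add_apply, RCLike.im_to_complex]
    rw [← sub_div, ← Complex.sub_im, ← Complex.div_ofReal_im,
      show -(m * b * t) = -(b * t) * (m : ℂ) by ring]
    congr 1
    ring
  rw [h1, h2, ← mul_add, hsum, mul_comm_div, mul_div_assoc', mul_sub, hA2, hB2,
    Complex.arg_real_mul _ hm, ha_def, hb_def, harg ⟨by linarith, by linarith [pi_pos]⟩,
    harg ⟨by linarith [pi_pos], by linarith [pi_pos]⟩]
  field_simp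
  ring

/-- The time integral of the signaling Green function is a tail integral of the Mainardi
function, by the substitution `u = x / t ^ ν`. -/
lemma integral_greenSignaling {ν : ℝ} (hν : 0 < ν) {m : ℝ} (hm : 0 < m) {x : ℝ} (hx : 0 < x) :
    ∫ t in (0 : ℝ)..((x / m) ^ (1 / ν)), greenSignaling ν x t = ∫ u in Ioi m, mainardi ν u := by
  set T := (x / m) ^ (1 / ν) with hT
  have hxm : 0 < x / m := div_pos hx hm
  have hT0 : 0 < T := rpow_pos_of_pos hxm _
  have hTν : T ^ ν = x / m := by rw [hT, ← rpow_mul hxm.le, one_div_mul_cancel hν.ne', rpow_one]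
  have hcomp := integral_comp_mul_left_Ioi ((Ioi m).indicator (mainardi ν)) 0 hx
  rw [mul_zero, ← integral_comp_rpow_Ioi _ (neg_ne_zero.2 hν.ne'), eq_inv_smul_iff₀ hx.ne',
    smul_eq_mul, ← integral_const_mul, setIntegral_indicator measurableSet_Ioi,
    Ioi_inter_Ioi, sup_eq_right.2 hm.le] at hcomp
  rw [← hcomp, intervalIntegral.integral_of_le hT0.le, integral_Ioc_eq_integral_Ioo,
    ← Ioi_inter_Iio, ← setIntegral_indicator measurableSet_Iio]
  refine setIntegral_congr_fun measurableSet_Ioi fun t ht ↦ ?_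
  have ht : 0 < t := ht
  have htν : 0 < t ^ ν := rpow_pos_of_pos ht ν
  have hmem : t ∈ Iio T ↔ x * t ^ (-ν) ∈ Ioi m := by
    rw [mem_Iio, mem_Ioi, ← rpow_lt_rpow_iff ht.le hT0.le hν, hTν, rpow_neg ht.le,
      ← div_eq_mul_inv, lt_div_comm₀ htν hm]
  simp only [indicator_apply, hmem, smul_eq_mul, abs_neg, abs_of_pos hν]
  split_ifs with h
  · rw [greenSignaling, show -ν - 1 = -(ν + 1) by ring, rpow_neg ht.le, rpow_neg ht.le,
      div_eq_mul_inv x (t ^ ν)]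
    ring
  · simp

theorem greenSignaling_median (ν : ℝ) (hν0 : 1 / 2 ≤ ν) (hν1 : ν < 1)
    (m : ℝ) (hm : 0 < m) (hmed : ∫ u in (0 : ℝ)..m, mainardi ν u = 1 / 2)
    (x : ℝ) (hx : 0 < x) :
    ∫ t in (0 : ℝ)..((x / m) ^ (1 / ν)), greenSignaling ν x t = 1 / 2 := by
  rw [integral_greenSignaling (by linarith) hm hx]
  linarith [integral_mainardi_add_integral_Ioi hν0 hν1 hm]
end

section
/- For every 0 < ν < 1 and every t > 0, the center of gravity of the Cauchy Green function on the positive half-line is located at (∫₀^∞ r · G_c(r,t;ν) dr) / (∫₀^∞ G_c(r,t;ν) dr) = t^ν / Γ(1 + ν), both integrals being convergent and the denominator equal to 1/2. -/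
open Real MeasureTheory Set

/-- The Green function of the Cauchy problem for the time-fractional
diffusion-wave equation: `G_c(x,t;ν) = M_ν(|x|/t^ν)/(2 t^ν)`. -/
noncomputable def greenCauchy (ν x t : ℝ) : ℝ :=
  mainardi ν (|x| / t ^ ν) / (2 * t ^ ν)

open Filter Topology

lemma norm_cexp_neg_ray (θ x : ℝ) :
    ‖Complex.exp (-Complex.exp (θ * Complex.I) * x)‖ = rexp (-Real.cos θ * x) := by
  rw [Complex.norm_exp]
  simp [Complex.exp_ofReal_mul_I_re]

lemma integrableOn_rpow_mul_exp_neg {s b : ℝ} (hs : -1 < s) (hb : 0 < b) :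
    IntegrableOn (fun x : ℝ => x ^ s * rexp (-b * x)) (Ioi 0) := by
  simpa using integrableOn_rpow_mul_exp_neg_mul_rpow hs one_pos hb

lemma integrableOn_rpow_mul_cexp_neg_ray {s θ : ℝ} (hs : -1 < s) (hθ : 0 < Real.cos θ) :
    IntegrableOn (fun x : ℝ => ((x ^ s : ℝ) : ℂ) * Complex.exp (-Complex.exp (θ * Complex.I) * x))
      (Ioi 0) := by
  refine (integrableOn_rpow_mul_exp_neg hs hθ).mono' (by fun_prop) ?_
  refine (ae_restrict_iff' measurableSet_Ioi).2 (.of_forall fun x hx => ?_)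
  rw [norm_mul, norm_cexp_neg_ray, Complex.norm_real, Real.norm_of_nonneg (rpow_nonneg hx.le _)]

lemma exp_ray_mul_integral_rpow {a θ : ℝ} (ha : 0 < a) (hθ : 0 < Real.cos θ) :
    Complex.exp (θ * Complex.I) * ∫ x in Ioi (0 : ℝ),
        ((x ^ a : ℝ) : ℂ) * Complex.exp (-Complex.exp (θ * Complex.I) * x) =
      a * ∫ x in Ioi (0 : ℝ),
        ((x ^ (a - 1) : ℝ) : ℂ) * Complex.exp (-Complex.exp (θ * Complex.I) * x) := by
  set r := Complex.exp (θ * Complex.I)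
  have h1 := (integrableOn_rpow_mul_cexp_neg_ray (s := a - 1) (by linarith) hθ).const_mul (a : ℂ)
  have h2 := (integrableOn_rpow_mul_cexp_neg_ray (s := a) (by linarith) hθ).const_mul r
  have key := integral_Ioi_of_hasDerivAt_of_tendsto (a := 0) (m := 0)
    (f := fun x : ℝ => ((x ^ a : ℝ) : ℂ) * Complex.exp (-r * x)) ?_ (fun x hx => ?_)
    (h1.sub h2) ?_
  · simp only [Pi.sub_apply] at key
    rw [integral_sub h1 h2, integral_const_mul, integral_const_mul] at key
    simp only [Real.zero_rpow ha.ne', Complex.ofReal_zero, zero_mul, sub_zero] at key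
    exact (sub_eq_zero.1 key).symm
  · have : ContinuousAt (fun x : ℝ => x ^ a) 0 := Real.continuousAt_rpow_const _ _ (.inr ha.le)
    exact (ContinuousAt.mul (Complex.continuous_ofReal.continuousAt.comp this)
      (by fun_prop)).continuousWithinAt
  · have d1 := (Real.hasDerivAt_rpow_const (x := x) (p := a) (.inl (ne_of_gt hx))).ofReal_comp
    have d2 : HasDerivAt (fun x : ℝ => Complex.exp (-r * x)) (Complex.exp (-r * x) * (-r)) x := by
      simpa using ((Complex.ofRealCLM.hasDerivAt (x := x)).const_mul (-r)).cexp
    refine (d1.mul d2).congr_deriv ?_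
    simp only [Pi.sub_apply]
    push_cast
    ring
  · rw [tendsto_zero_iff_norm_tendsto_zero]
    refine (tendsto_rpow_mul_exp_neg_mul_atTop_nhds_zero a _ hθ).congr' ?_
    filter_upwards [eventually_ge_atTop 0] with x hx
    rw [norm_mul, norm_cexp_neg_ray, Complex.norm_real, Real.norm_of_nonneg (rpow_nonneg hx _)]

lemma hasDerivAt_integral_ray {a θ : ℝ} (ha : 0 < a) (hθ : 0 < Real.cos θ) :
    HasDerivAt (fun θ : ℝ => ∫ x in Ioi (0 : ℝ),
        ((x ^ (a - 1) : ℝ) : ℂ) * Complex.exp (-Complex.exp (θ * Complex.I) * x))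
      (-(a * Complex.I) * ∫ x in Ioi (0 : ℝ),
        ((x ^ (a - 1) : ℝ) : ℂ) * Complex.exp (-Complex.exp (θ * Complex.I) * x)) θ := by
  have hs : {η : ℝ | Real.cos θ / 2 < Real.cos η} ∈ 𝓝 θ :=
    (isOpen_lt continuous_const Real.continuous_cos).mem_nhds (by simp; linarith)
  have key := (hasDerivAt_integral_of_dominated_loc_of_deriv_le (μ := volume.restrict (Ioi 0))
    (F := fun (θ x : ℝ) =>
      ((x ^ (a - 1) : ℝ) : ℂ) * Complex.exp (-Complex.exp (θ * Complex.I) * x))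
    (F' := fun (θ x : ℝ) => -Complex.I * (Complex.exp (θ * Complex.I) *
      (((x ^ a : ℝ) : ℂ) * Complex.exp (-Complex.exp (θ * Complex.I) * x))))
    (bound := fun x => x ^ a * rexp (-(Real.cos θ / 2) * x)) hs
    (.of_forall fun _ => by fun_prop)
    (integrableOn_rpow_mul_cexp_neg_ray (by linarith) hθ) (by fun_prop) ?_
    (integrableOn_rpow_mul_exp_neg (by linarith) (by linarith)) ?_).2
  · rw [integral_const_mul, integral_const_mul, exp_ray_mul_integral_rpow ha hθ] at key
    exact key.congr_deriv (by ring)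
  · refine (ae_restrict_iff' measurableSet_Ioi).2 (.of_forall fun x hx η hη => ?_)
    have hx' : 0 < x := hx
    have hη' : Real.cos θ / 2 < Real.cos η := hη
    rw [norm_mul, norm_mul, norm_mul, norm_cexp_neg_ray, Complex.norm_real,
      Real.norm_of_nonneg (rpow_nonneg hx'.le _), norm_neg, Complex.norm_I,
      Complex.norm_exp_ofReal_mul_I, one_mul, one_mul]
    gcongr
  · refine (ae_restrict_iff' measurableSet_Ioi).2 (.of_forall fun x hx η _ => ?_)
    have hx' : 0 < x := hx
    have d : HasDerivAt (fun η : ℝ => Complex.exp (-Complex.exp (η * Complex.I) * x))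
        (Complex.exp (-Complex.exp (η * Complex.I) * x) *
          (-(Complex.exp (η * Complex.I) * Complex.I) * x)) η := by
      simpa using (((Complex.ofRealCLM.hasDerivAt (x := η)).mul_const
        Complex.I).cexp.neg.mul_const (x : ℂ)).cexp
    refine (d.const_mul _).congr_deriv ?_
    have : x ^ a = x ^ (a - 1) * x := by
      rw [← Real.rpow_add_one hx'.ne', sub_add_cancel]
    rw [this]
    push_cast
    ring

/-- Euler's integral for the Gamma function along the ray of argument `θ`. -/
lemma integral_rpow_mul_cexp_neg_ray {a θ : ℝ} (ha : 0 < a) (hθ : |θ| < π / 2) :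
    ∫ x in Ioi (0 : ℝ), ((x ^ (a - 1) : ℝ) : ℂ) * Complex.exp (-Complex.exp (θ * Complex.I) * x) =
      Complex.exp (-(θ * a * Complex.I)) * Real.Gamma a := by
  set g : ℝ → ℂ := fun θ => ∫ x in Ioi (0 : ℝ),
    ((x ^ (a - 1) : ℝ) : ℂ) * Complex.exp (-Complex.exp (θ * Complex.I) * x) with hg
  have hd : ∀ η ∈ Ioo (-(π / 2)) (π / 2),
      HasDerivAt (fun η : ℝ => Complex.exp (η * a * Complex.I) * g η) 0 η := fun η hη => by
    have d : HasDerivAt (fun η : ℝ => Complex.exp (η * a * Complex.I))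
        (Complex.exp (η * a * Complex.I) * (a * Complex.I)) η := by
      simpa using (((Complex.ofRealCLM.hasDerivAt (x := η)).mul_const (a : ℂ)).mul_const
        Complex.I).cexp
    refine (d.mul (hasDerivAt_integral_ray ha (Real.cos_pos_of_mem_Ioo hη))).congr_deriv ?_
    ring
  have h0 : (0 : ℝ) ∈ Ioo (-(π / 2)) (π / 2) := by constructor <;> linarith [Real.pi_pos]
  have hc := isOpen_Ioo.is_const_of_deriv_eq_zero isPreconnected_Ioo
    (fun η hη => (hd η hη).differentiableAt.differentiableWithinAt)
    (fun η hη => (hd η hη).deriv) (abs_lt.1 hθ) h0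
  have hg0 : g 0 = Real.Gamma a := by
    rw [Real.Gamma_eq_integral ha, ← integral_complex_ofReal]
    refine setIntegral_congr_fun measurableSet_Ioi fun x _ => ?_
    simp [mul_comm]
  simp only [hg0, Complex.ofReal_zero, zero_mul, Complex.exp_zero, one_mul] at hc
  rw [← hc, ← mul_assoc, ← Complex.exp_add]
  simp [hg]

lemma integral_rpow_mul_cexp_neg_mul_ray {a θ w : ℝ} (ha : 0 < a) (hθ : |θ| < π / 2) (hw : 0 < w) :
    ∫ x in Ioi (0 : ℝ),
        ((x ^ (a - 1) : ℝ) : ℂ) * Complex.exp (-Complex.exp (θ * Complex.I) * (w * x : ℝ)) =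
      (w ^ (-a) : ℝ) * (Complex.exp (-(θ * a * Complex.I)) * Real.Gamma a) := by
  have h := integral_comp_mul_left_Ioi (fun x : ℝ => ((w ^ (1 - a) : ℝ) : ℂ) *
    (((x ^ (a - 1) : ℝ) : ℂ) * Complex.exp (-Complex.exp (θ * Complex.I) * x))) 0 hw
  rw [mul_zero, integral_const_mul, integral_const_mul, integral_rpow_mul_cexp_neg_ray ha hθ, Complex.real_smul,
    ← mul_assoc _ _ (_ * _), ← Complex.ofReal_mul] at h
  have e : w⁻¹ * w ^ (1 - a) = w ^ (-a) := by
    rw [← Real.rpow_neg_one, ← Real.rpow_add hw]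
    ring_nf
  rw [e] at h
  rw [← h, ← integral_const_mul]
  refine setIntegral_congr_fun measurableSet_Ioi fun x hx => ?_
  have : w ^ (1 - a) * (w * x) ^ (a - 1) = x ^ (a - 1) := by
    rw [Real.mul_rpow hw.le (le_of_lt hx), ← mul_assoc, ← Real.rpow_add hw]
    simp
  rw [← this]
  push_cast
  ring

lemma hasSum_cexp (z : ℂ) : HasSum (fun n : ℕ => z ^ n / n.factorial) (Complex.exp z) := by
  rw [Complex.exp_eq_exp_ℂ]
  exact NormedSpace.expSeries_div_hasSum_exp z

lemma exists_mul_rpow_le {ν δ : ℝ} (hν0 : 0 < ν) (hν1 : ν < 1) (hδ : 0 < δ) {x : ℝ} (hx : 0 ≤ x) :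
    ∃ K, ∀ u : ℝ, 0 ≤ u → x * u ^ ν ≤ δ * u + K := by
  have h1 : 0 < 1 - ν := sub_pos.2 hν1
  refine ⟨(x / δ ^ ν) ^ (1 / (1 - ν)), fun u hu => ?_⟩
  set K := (x / δ ^ ν) ^ (1 / (1 - ν)) with hK
  have hK0 : 0 ≤ K := by positivity
  have h := Real.geom_mean_le_arith_mean2_weighted hν0.le h1.le (mul_nonneg hδ.le hu) hK0 (by ring)
  have e : (δ * u) ^ ν * K ^ (1 - ν) = x * u ^ ν := by
    have := (Real.rpow_pos_of_pos hδ ν).ne'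
    rw [hK, ← Real.rpow_mul (by positivity), one_div_mul_cancel h1.ne', Real.rpow_one,
      Real.mul_rpow hδ.le hu]
    field_simp
  rw [e] at h
  nlinarith [mul_nonneg hδ.le hu]

lemma integrableOn_rpow_mul_exp_neg_add {s ν ρ x : ℝ} (hs : -1 < s) (hν0 : 0 < ν) (hν1 : ν < 1)
    (hρ : 0 < ρ) (hx : 0 ≤ x) :
    IntegrableOn (fun u : ℝ => u ^ s * rexp (-ρ * u) * rexp (x * u ^ ν)) (Ioi 0) := by
  obtain ⟨K, hK⟩ := exists_mul_rpow_le hν0 hν1 (half_pos hρ) hx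
  refine ((integrableOn_rpow_mul_exp_neg hs (half_pos hρ)).mul_const (rexp K)).mono'
    (by fun_prop) ?_
  refine (ae_restrict_iff' measurableSet_Ioi).2 (.of_forall fun u hu => ?_)
  have hu' : 0 < u := hu
  rw [Real.norm_of_nonneg (by positivity), mul_assoc, mul_assoc, ← Real.exp_add, ← Real.exp_add]
  refine mul_le_mul_of_nonneg_left (Real.exp_le_exp.2 ?_) (by positivity)
  linarith [hK u hu'.le]

lemma one_div_Gamma_one_sub {y : ℝ} (hy : 0 < y) :
    1 / Real.Gamma (1 - y) = Real.Gamma y * Real.sin (π * y) / π := by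
  have h := Real.Gamma_mul_Gamma_one_sub y
  have hG := (Real.Gamma_pos_of_pos hy).ne'
  by_cases hs : Real.sin (π * y) = 0
  · rw [hs, div_zero] at h
    simp [(mul_eq_zero.1 h).resolve_left hG, hs]
  · have : Real.Gamma (1 - y) ≠ 0 := fun h0 => by
      rw [h0, mul_zero] at h
      exact (div_ne_zero Real.pi_ne_zero hs) h.symm
    have := Real.pi_ne_zero
    rw [eq_div_iff hs] at h
    rw [div_eq_div_iff (by assumption) (by assumption)]
    linarith

/-- The integrand whose integral over `u > 0` has imaginary part `π * mainardi ν x`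
when `α = ν * (π + θ)`. -/
noncomputable def mainardiKernel (ν θ α x u : ℝ) : ℂ :=
  Complex.exp (α * Complex.I) * (u ^ (ν - 1) : ℝ) * Complex.exp (-Complex.exp (θ * Complex.I) * u) *
    Complex.exp (-Complex.exp (α * Complex.I) * (x * u ^ ν : ℝ))

lemma mainardi_eq_im_integral_s9 {ν θ α : ℝ} (hν0 : 0 < ν) (hν1 : ν < 1) (hθ : |θ| < π / 2)
    (hα : α = ν * (π + θ)) (x : ℝ) :
    mainardi ν x = (∫ u in Ioi (0 : ℝ), mainardiKernel ν θ α x u).im / π := by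
  have hcos := Real.cos_pos_of_mem_Ioo (abs_lt.1 hθ)
  set c := Complex.exp (α * Complex.I) with hc
  set r := Complex.exp (θ * Complex.I) with hr
  have hcn : ‖c‖ = 1 := Complex.norm_exp_ofReal_mul_I α
  have hsum := hasSum_integral_of_dominated_convergence (μ := volume.restrict (Ioi 0))
    (F := fun (n : ℕ) (u : ℝ) => c * (u ^ (ν - 1) : ℝ) * Complex.exp (-r * u) *
      ((-c * (x * u ^ ν : ℝ)) ^ n / n.factorial))
    (f := mainardiKernel ν θ α x)
    (fun n u => u ^ (ν - 1) * rexp (-Real.cos θ * u) * ((|x| * u ^ ν) ^ n / n.factorial))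
    (fun n => by fun_prop) (fun n => ?_) ?_ ?_ ?_
  · rw [mainardi, ← (Complex.hasSum_im hsum).tsum_eq, ← tsum_div_const]
    refine tsum_congr fun n => ?_
    have hn : (0 : ℝ) < ν * (n + 1) := by positivity
    have hint : ∫ u in Ioi (0 : ℝ), c * (u ^ (ν - 1) : ℝ) * Complex.exp (-r * u) *
        ((-c * (x * u ^ ν : ℝ)) ^ n / n.factorial) =
        (((-x) ^ n / n.factorial * Real.Gamma (ν * (n + 1)) : ℝ) : ℂ) *
          Complex.exp ((π * (ν * (n + 1)) : ℝ) * Complex.I) := by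
      calc _ = ∫ u in Ioi (0 : ℝ), (c ^ (n + 1) * ((-x) ^ n / n.factorial : ℝ)) *
            (((u ^ (ν * (n + 1) - 1) : ℝ) : ℂ) * Complex.exp (-r * u)) := by
            refine setIntegral_congr_fun measurableSet_Ioi fun u hu => ?_
            have hu' : 0 < u := hu
            have : u ^ (ν * (n + 1) - 1) = u ^ (ν - 1) * (u ^ ν) ^ n := by
              rw [← Real.rpow_mul_natCast hu'.le, ← Real.rpow_add hu']
              ring_nf
            rw [this]
            push_cast
            rw [mul_pow, mul_pow, neg_pow c, neg_pow (x : ℂ)]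
            ring
        _ = _ := by
            rw [integral_const_mul, integral_rpow_mul_cexp_neg_ray hn hθ, hc, ← Complex.exp_nat_mul]
            have : Complex.exp ((π * (ν * (n + 1)) : ℝ) * Complex.I) =
                Complex.exp ((n + 1 : ℕ) * (α * Complex.I)) *
                  Complex.exp (-(θ * (ν * (n + 1) : ℝ) * Complex.I)) := by
              rw [← Complex.exp_add, hα]
              push_cast
              ring_nf
            rw [this]
            push_cast
            ring
    rw [hint, Complex.im_ofReal_mul, Complex.exp_ofReal_mul_I_im]
    have h := one_div_Gamma_one_sub hn
    rw [show 1 - ν - ν * n = 1 - ν * (n + 1) by ring, ← div_div, div_eq_mul_one_div _ (Real.Gamma _),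
      h]
    ring
  · refine (ae_restrict_iff' measurableSet_Ioi).2 (.of_forall fun u hu => ?_)
    have hu' : 0 < u := hu
    simp only [norm_mul, norm_div, norm_pow, norm_neg, hcn, hr, norm_cexp_neg_ray,
      Complex.norm_real, Complex.norm_natCast, one_mul, Real.norm_eq_abs]
    rw [abs_of_nonneg (rpow_nonneg hu'.le _), abs_of_nonneg (rpow_nonneg hu'.le _)]
  · exact .of_forall fun u => (Real.summable_pow_div_factorial _).mul_left _
  · have e : ∀ u : ℝ, ∑' n : ℕ, u ^ (ν - 1) * rexp (-Real.cos θ * u) *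
        ((|x| * u ^ ν) ^ n / n.factorial) =
        u ^ (ν - 1) * rexp (-Real.cos θ * u) * rexp (|x| * u ^ ν) := fun u => by
      rw [tsum_mul_left, Real.exp_eq_exp_ℝ, NormedSpace.exp_eq_tsum_div]
    simp only [e]
    exact integrableOn_rpow_mul_exp_neg_add (by linarith) hν0 hν1 hcos (abs_nonneg x)
  · refine .of_forall fun u => ?_
    exact (hasSum_cexp _).mul_left _

lemma integrableOn_mainardiKernel {ν θ α x : ℝ} (hν0 : 0 < ν) (hθ : 0 < Real.cos θ)
    (hα : 0 < Real.cos α) (hx : 0 ≤ x) :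
    IntegrableOn (mainardiKernel ν θ α x) (Ioi 0) ∧
      ‖∫ u in Ioi (0 : ℝ), mainardiKernel ν θ α x u‖ ≤
        ∫ u in Ioi (0 : ℝ), u ^ (ν - 1) * rexp (-Real.cos θ * u) := by
  have hint := integrableOn_rpow_mul_exp_neg (s := ν - 1) (by linarith) hθ
  have hb : ∀ᵐ u ∂volume.restrict (Ioi (0 : ℝ)),
      ‖mainardiKernel ν θ α x u‖ ≤ u ^ (ν - 1) * rexp (-Real.cos θ * u) := by
    refine (ae_restrict_iff' measurableSet_Ioi).2 (.of_forall fun u hu => ?_)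
    have hu' : 0 < u := hu
    rw [mainardiKernel, norm_mul, norm_mul, norm_mul, norm_cexp_neg_ray, norm_cexp_neg_ray,
      Complex.norm_exp_ofReal_mul_I, one_mul, Complex.norm_real,
      Real.norm_of_nonneg (rpow_nonneg hu'.le _)]
    refine mul_le_of_le_one_right (by positivity) (Real.exp_le_one_iff.2 ?_)
    have : 0 ≤ Real.cos α * (x * u ^ ν) := by positivity
    linarith
  exact ⟨hint.mono' (by unfold mainardiKernel; fun_prop) hb, norm_integral_le_of_norm_le hint hb⟩

lemma integral_rpow_mul_cexp_neg_ray_rpow {ν α x : ℝ} (hν0 : 0 < ν) (hα : |α| < π / 2)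
    (hx : 0 < x) :
    IntegrableOn (fun u : ℝ => Complex.exp (α * Complex.I) * (u ^ (ν - 1) : ℝ) *
      Complex.exp (-Complex.exp (α * Complex.I) * (x * u ^ ν : ℝ))) (Ioi 0) ∧
    ∫ u in Ioi (0 : ℝ), Complex.exp (α * Complex.I) * (u ^ (ν - 1) : ℝ) *
      Complex.exp (-Complex.exp (α * Complex.I) * (x * u ^ ν : ℝ)) = ((ν * x)⁻¹ : ℝ) := by
  have hcos := Real.cos_pos_of_mem_Ioo (abs_lt.1 hα)
  set c := Complex.exp (α * Complex.I) with hc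
  have hre : (-c * x).re < 0 := by
    simp only [hc, neg_mul, Complex.neg_re, Complex.re_mul_ofReal, Complex.exp_ofReal_mul_I_re]
    nlinarith [mul_pos hcos hx]
  have hi := integrableOn_exp_mul_complex_Ioi hre 0
  have hI := integral_exp_mul_complex_Ioi hre 0
  have hi' := ((integrableOn_Ioi_comp_rpow_iff _ hν0.ne').2 hi).const_mul (c / ν)
  have hI' := integral_comp_rpow_Ioi (fun y : ℝ => Complex.exp (-c * x * y)) hν0.ne'
  have hν : (ν : ℂ) ≠ 0 := by exact_mod_cast hν0.ne'
  have e : ∀ u : ℝ, c / ν * ((|ν| * u ^ (ν - 1)) • Complex.exp (-c * x * (u ^ ν : ℝ))) =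
      c * (u ^ (ν - 1) : ℝ) * Complex.exp (-c * (x * u ^ ν : ℝ)) := fun u => by
    rw [abs_of_pos hν0, Complex.real_smul]
    push_cast
    field_simp
  simp only [e] at hi'
  refine ⟨hi', ?_⟩
  simp only [← e]
  rw [integral_const_mul, hI', hI]
  have hc0 : c ≠ 0 := Complex.exp_ne_zero _
  have hx0 : (x : ℂ) ≠ 0 := by exact_mod_cast hx.ne'
  push_cast
  simp only [mul_zero, Complex.exp_zero]
  field_simp

/-- `mainardiKernel` with `exp (-e^{iθ} u)` replaced by `exp (-e^{iθ} u) - 1`. -/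
noncomputable def mainardiKernelSub (ν θ α x u : ℝ) : ℂ :=
  Complex.exp (α * Complex.I) * (u ^ (ν - 1) : ℝ) *
    (Complex.exp (-Complex.exp (θ * Complex.I) * u) - 1) *
    Complex.exp (-Complex.exp (α * Complex.I) * (x * u ^ ν : ℝ))

lemma mainardi_eq_im_integral_sub {ν θ α x : ℝ} (hν0 : 0 < ν) (hν1 : ν < 1) (hθ : |θ| < π / 2)
    (hα : α = ν * (π + θ)) (hα' : |α| < π / 2) (hx : 0 < x) :
    mainardi ν x = (∫ u in Ioi (0 : ℝ), mainardiKernelSub ν θ α x u).im / π := by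
  obtain ⟨hi, hI⟩ := integral_rpow_mul_cexp_neg_ray_rpow hν0 hα' hx
  have hK := (integrableOn_mainardiKernel hν0 (Real.cos_pos_of_mem_Ioo (abs_lt.1 hθ))
    (Real.cos_pos_of_mem_Ioo (abs_lt.1 hα')) hx.le).1
  have e : ∀ u, mainardiKernelSub ν θ α x u = mainardiKernel ν θ α x u -
      Complex.exp (α * Complex.I) * (u ^ (ν - 1) : ℝ) *
      Complex.exp (-Complex.exp (α * Complex.I) * (x * u ^ ν : ℝ)) := fun u => by
    rw [mainardiKernelSub, mainardiKernel]
    ring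
  simp only [e]
  rw [integral_sub hK hi, hI, Complex.sub_im, Complex.ofReal_im, sub_zero,
    mainardi_eq_im_integral_s9 hν0 hν1 hθ hα]

lemma norm_cexp_neg_ray_sub_one_le {θ u : ℝ} (hθ : 0 < Real.cos θ) (hu : 0 ≤ u) :
    ‖Complex.exp (-Complex.exp (θ * Complex.I) * u) - 1‖ ≤ 2 * u ∧
      ‖Complex.exp (-Complex.exp (θ * Complex.I) * u) - 1‖ ≤ 2 := by
  have h2 : ‖Complex.exp (-Complex.exp (θ * Complex.I) * u) - 1‖ ≤ 2 := by
    refine (norm_sub_le _ _).trans ?_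
    rw [norm_cexp_neg_ray, norm_one]
    have : rexp (-Real.cos θ * u) ≤ 1 := Real.exp_le_one_iff.2 (by nlinarith [mul_nonneg hθ.le hu])
    linarith
  refine ⟨?_, h2⟩
  rcases le_total u 1 with h | h
  · have hn : ‖-Complex.exp (θ * Complex.I) * u‖ = u := by
      rw [norm_mul, norm_neg, Complex.norm_exp_ofReal_mul_I, one_mul, Complex.norm_real,
        Real.norm_of_nonneg hu]
    have := Complex.norm_exp_sub_one_le (hn.trans_le h)
    rwa [hn] at this
  · linarith

lemma integrableOn_rpow_mul_cexp_sub_one {b θ : ℝ} (hb0 : 0 < b) (hb1 : b < 1)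
    (hθ : 0 < Real.cos θ) :
    IntegrableOn (fun u : ℝ => ((u ^ (-1 - b) : ℝ) : ℂ) *
      (Complex.exp (-Complex.exp (θ * Complex.I) * u) - 1)) (Ioi 0) := by
  rw [← Ioc_union_Ioi_eq_Ioi zero_le_one]
  refine IntegrableOn.union ?_ ?_
  · have h : IntegrableOn (fun u : ℝ => u ^ (-b)) (Ioc 0 1) :=
      (intervalIntegrable_iff_integrableOn_Ioc_of_le zero_le_one).1
        (intervalIntegral.intervalIntegrable_rpow' (by linarith))
    refine (h.const_mul 2).mono' (by fun_prop) ?_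
    refine (ae_restrict_iff' measurableSet_Ioc).2 (.of_forall fun u hu => ?_)
    rw [norm_mul, Complex.norm_real, Real.norm_of_nonneg (rpow_nonneg hu.1.le _)]
    calc _ ≤ u ^ (-1 - b) * (2 * u) :=
          mul_le_mul_of_nonneg_left (norm_cexp_neg_ray_sub_one_le hθ hu.1.le).1
            (rpow_nonneg hu.1.le _)
      _ = 2 * (u ^ (-1 - b) * u) := by ring
      _ = 2 * u ^ (-b) := by
          rw [← Real.rpow_add_one hu.1.ne']
          ring_nf
  · refine ((integrableOn_Ioi_rpow_of_lt (a := -1 - b) (by linarith) one_pos).const_mul 2).mono'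
      (by fun_prop) ?_
    refine (ae_restrict_iff' measurableSet_Ioi).2 (.of_forall fun u hu => ?_)
    have hu' : 0 < u := zero_lt_one.trans hu
    rw [norm_mul, Complex.norm_real, Real.norm_of_nonneg (rpow_nonneg hu'.le _), mul_comm]
    exact mul_le_mul_of_nonneg_right (norm_cexp_neg_ray_sub_one_le hθ hu'.le).2
      (rpow_nonneg hu'.le _)

lemma integral_rpow_mul_cexp_sub_one {b θ : ℝ} (hb0 : 0 < b) (hb1 : b < 1) (hθ : |θ| < π / 2) :
    ∫ u in Ioi (0 : ℝ), ((u ^ (-1 - b) : ℝ) : ℂ) *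
      (Complex.exp (-Complex.exp (θ * Complex.I) * u) - 1) =
      -((Real.Gamma (1 - b) / b : ℝ) * Complex.exp ((θ * b : ℝ) * Complex.I)) := by
  have hcos := Real.cos_pos_of_mem_Ioo (abs_lt.1 hθ)
  have hG := integral_rpow_mul_cexp_neg_ray (a := 1 - b) (by linarith) hθ
  rw [show 1 - b - 1 = -b by ring] at hG
  have h1 := (integrableOn_rpow_mul_cexp_sub_one hb0 hb1 hcos).const_mul (-b : ℂ)
  have h2 := (integrableOn_rpow_mul_cexp_neg_ray (s := -b) (by linarith) hcos).const_mul
    (Complex.exp (θ * Complex.I))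
  set r := Complex.exp (θ * Complex.I) with hr
  have key := integral_Ioi_of_hasDerivAt_of_tendsto (a := 0) (m := 0)
    (f := fun u : ℝ => ((u ^ (-b) : ℝ) : ℂ) * (Complex.exp (-r * u) - 1)) ?_ (fun u hu => ?_)
    (h1.sub h2) ?_
  · simp only [Pi.sub_apply] at key
    rw [integral_sub h1 h2, integral_const_mul, integral_const_mul, hG] at key
    simp only [Complex.ofReal_zero, mul_zero, Complex.exp_zero, sub_self] at key
    have hb : (b : ℂ) ≠ 0 := by exact_mod_cast hb0.ne'
    have he : Complex.exp ((θ * b : ℝ) * Complex.I) =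
        r * Complex.exp (-(θ * (1 - b : ℝ) * Complex.I)) := by
      rw [hr, ← Complex.exp_add]
      push_cast
      ring_nf
    rw [he, Complex.ofReal_div]
    refine mul_left_cancel₀ hb ?_
    rw [mul_neg, ← mul_assoc (b : ℂ) (_ / _), mul_div_cancel₀ _ hb]
    linear_combination -key
  · have hz : Tendsto (fun u : ℝ => 2 * u ^ (1 - b)) (𝓝[≥] 0) (𝓝 0) := by
      have : ContinuousAt (fun u : ℝ => 2 * u ^ (1 - b)) 0 :=
        continuousAt_const.mul (Real.continuousAt_rpow_const _ _ (.inr (by linarith)))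
      have h := this.tendsto
      rw [Real.zero_rpow (by linarith), mul_zero] at h
      exact tendsto_nhdsWithin_of_tendsto_nhds h
    rw [ContinuousWithinAt]
    simp only [Complex.ofReal_zero, mul_zero, Complex.exp_zero, sub_self]
    refine squeeze_zero_norm' ?_ hz
    filter_upwards [self_mem_nhdsWithin] with u hu
    rcases eq_or_lt_of_le (show (0 : ℝ) ≤ u from hu) with rfl | hu'
    · simp [Real.zero_rpow (show 1 - b ≠ 0 by linarith)]
    rw [norm_mul, Complex.norm_real, Real.norm_of_nonneg (rpow_nonneg hu'.le _)]
    calc _ ≤ u ^ (-b) * (2 * u) := mul_le_mul_of_nonneg_left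
            (norm_cexp_neg_ray_sub_one_le hcos hu'.le).1 (rpow_nonneg hu'.le _)
      _ = 2 * (u ^ (-b) * u) := by ring
      _ = 2 * u ^ (1 - b) := by
          rw [← Real.rpow_add_one hu'.ne']
          ring_nf
  · have d1 := (Real.hasDerivAt_rpow_const (x := u) (p := -b) (.inl (ne_of_gt hu))).ofReal_comp
    have d2 : HasDerivAt (fun x : ℝ => Complex.exp (-r * x) - 1) (Complex.exp (-r * u) * (-r)) u := by
      simpa using ((Complex.ofRealCLM.hasDerivAt (x := u)).const_mul (-r)).cexp.sub_const 1
    refine (d1.mul d2).congr_deriv ?_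
    simp only [Pi.sub_apply]
    rw [show -b - 1 = -1 - b by ring]
    push_cast
    ring
  · have hz : Tendsto (fun u : ℝ => 2 * u ^ (-b)) atTop (𝓝 0) := by
      simpa using (tendsto_rpow_neg_atTop hb0).const_mul 2
    refine squeeze_zero_norm' ?_ hz
    filter_upwards [eventually_ge_atTop 0] with u hu
    rw [norm_mul, Complex.norm_real, Real.norm_of_nonneg (rpow_nonneg hu _), mul_comm]
    exact mul_le_mul_of_nonneg_right (norm_cexp_neg_ray_sub_one_le hcos hu).2 (rpow_nonneg hu _)

lemma exists_ray_angles {ν : ℝ} (hν0 : 0 < ν) (hν1 : ν < 1) :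
    ∃ θ α : ℝ, |θ| < π / 2 ∧ |α| < π / 2 ∧ α = ν * (π + θ) := by
  have hπ := Real.pi_pos
  refine ⟨-(π * ν / 2), ν * (π + -(π * ν / 2)), abs_lt.2 ⟨?_, ?_⟩, abs_lt.2 ⟨?_, ?_⟩, rfl⟩
  · nlinarith
  · nlinarith [mul_pos hπ hν0]
  · nlinarith [mul_pos hπ hν0, mul_pos (mul_pos hπ hν0) (sub_pos.2 hν1)]
  · nlinarith [mul_pos hπ (pow_pos (sub_pos.2 hν1) 2)]

/-- The moments of order `p ∈ (0, 1]` of the Mainardi function on the positive half-line. -/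
lemma integral_mellin_mainardi {ν p : ℝ} (hν0 : 0 < ν) (hν1 : ν < 1) (hp0 : 0 < p) (hp1 : p ≤ 1) :
    IntegrableOn (fun x : ℝ => x ^ p * mainardi ν x) (Ioi 0) ∧
      ∫ x in Ioi (0 : ℝ), x ^ p * mainardi ν x = Real.Gamma (p + 1) / Real.Gamma (1 + ν * p) := by
  obtain ⟨θ, α, hθ, hα', hα⟩ := exists_ray_angles hν0 hν1
  have hcθ := Real.cos_pos_of_mem_Ioo (abs_lt.1 hθ)
  have hcα := Real.cos_pos_of_mem_Ioo (abs_lt.1 hα')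
  have hb0 : 0 < ν * p := mul_pos hν0 hp0
  have hb1 : ν * p < 1 := by nlinarith
  have hp : 0 < p + 1 := by linarith
  set w : ℝ → ℂ := fun u => ((u ^ (-1 - ν * p) : ℝ) : ℂ) *
    (Complex.exp (-Complex.exp (θ * Complex.I) * u) - 1) with hw
  have hwi : IntegrableOn w (Ioi 0) := integrableOn_rpow_mul_cexp_sub_one hb0 hb1 hcθ
  set F : ℝ → ℝ → ℂ := fun x u => ((x ^ p : ℝ) : ℂ) * mainardiKernelSub ν θ α x u with hF
  have hpow : ∀ u : ℝ, 0 < u → u ^ (ν - 1) * (u ^ ν) ^ (-(p + 1)) = u ^ (-1 - ν * p) :=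
    fun u hu => by
      rw [← Real.rpow_mul hu.le, ← Real.rpow_add hu]
      ring_nf
  have hFeq : ∀ x u : ℝ, F x u = (Complex.exp (α * Complex.I) * (u ^ (ν - 1) : ℝ) *
      (Complex.exp (-Complex.exp (θ * Complex.I) * u) - 1)) * (((x ^ (p + 1 - 1) : ℝ) : ℂ) *
        Complex.exp (-Complex.exp (α * Complex.I) * (u ^ ν * x : ℝ))) := fun x u => by
    rw [hF]
    simp only [mainardiKernelSub]
    rw [add_sub_cancel_right, mul_comm x]
    ring
  have hFx : ∀ u ∈ Ioi (0 : ℝ), ∫ x in Ioi (0 : ℝ), F x u =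
      (Real.Gamma (p + 1) : ℂ) * Complex.exp (-(α * p : ℝ) * Complex.I) * w u := fun u hu => by
    simp only [hFeq]
    rw [integral_const_mul,
      integral_rpow_mul_cexp_neg_mul_ray hp hα' (Real.rpow_pos_of_pos hu ν), hw]
    simp only
    rw [← hpow u hu]
    have he : Complex.exp (-(α * p : ℝ) * Complex.I) =
        Complex.exp (α * Complex.I) * Complex.exp (-(α * (p + 1 : ℝ) * Complex.I)) := by
      rw [← Complex.exp_add]
      push_cast
      ring_nf
    rw [he, Complex.ofReal_mul]
    ring
  have hnorm : ∀ x ∈ Ioi (0 : ℝ), ∀ u ∈ Ioi (0 : ℝ), ‖F x u‖ = (u ^ (ν - 1) *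
      ‖Complex.exp (-Complex.exp (θ * Complex.I) * u) - 1‖) *
        (x ^ (p + 1 - 1) * rexp (-((Real.cos α * u ^ ν) * x))) := fun x hx u hu => by
    rw [hFeq, norm_mul, norm_mul, norm_mul, norm_mul, norm_cexp_neg_ray,
      Complex.norm_exp_ofReal_mul_I, Complex.norm_real, Complex.norm_real, one_mul,
      Real.norm_of_nonneg (rpow_nonneg (le_of_lt hx) _),
      Real.norm_of_nonneg (rpow_nonneg (le_of_lt hu) _)]
    ring_nf
  have hmeas : Measurable (Function.uncurry F) := by
    simp only [hF, mainardiKernelSub]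
    fun_prop
  have hprod : Integrable (Function.uncurry F)
      ((volume.restrict (Ioi (0 : ℝ))).prod (volume.restrict (Ioi (0 : ℝ)))) := by
    refine (integrable_prod_iff' hmeas.aestronglyMeasurable).2 ⟨?_, ?_⟩
    · refine (ae_restrict_iff' measurableSet_Ioi).2 (.of_forall fun u hu => ?_)
      have hc : 0 < Real.cos α * u ^ ν := mul_pos hcα (Real.rpow_pos_of_pos hu ν)
      refine ((integrableOn_rpow_mul_exp_neg (s := p + 1 - 1) (by linarith) hc).const_mul
        (u ^ (ν - 1) * ‖Complex.exp (-Complex.exp (θ * Complex.I) * u) - 1‖)).mono'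
        (by simp only [hF, mainardiKernelSub, Function.uncurry]; fun_prop) ?_
      refine (ae_restrict_iff' measurableSet_Ioi).2 (.of_forall fun x hx => ?_)
      rw [Function.uncurry_apply_pair, hnorm x hx u hu, neg_mul (Real.cos α * u ^ ν)]
    · refine (hwi.norm.const_mul ((1 / Real.cos α) ^ (p + 1) * Real.Gamma (p + 1))).congr ?_
      refine (ae_restrict_iff' measurableSet_Ioi).2 (.of_forall fun u hu => ?_)
      have hu' : 0 < u := hu
      have huν := Real.rpow_pos_of_pos hu' ν
      simp only [Function.uncurry_apply_pair]
      rw [setIntegral_congr_fun measurableSet_Ioi fun x hx => hnorm x hx u hu,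
        integral_const_mul, Real.integral_rpow_mul_exp_neg_mul_Ioi hp (mul_pos hcα huν), hw,
        norm_mul, Complex.norm_real, Real.norm_of_nonneg (rpow_nonneg hu'.le _), ← hpow u hu',
        Real.rpow_neg huν.le, ← one_div_mul_one_div, Real.mul_rpow (by positivity) (by positivity),
        Real.div_rpow zero_le_one huν.le, Real.one_rpow]
      ring
  have hM : ∀ x ∈ Ioi (0 : ℝ), (∫ u in Ioi (0 : ℝ), F x u).im / π = x ^ p * mainardi ν x :=
    fun x hx => by
      rw [mainardi_eq_im_integral_sub hν0 hν1 hθ hα hα' hx, hF]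
      simp only
      rw [integral_const_mul, Complex.im_ofReal_mul, mul_div_assoc]
  have hint : Integrable (fun x => ∫ u in Ioi (0 : ℝ), F x u) (volume.restrict (Ioi (0 : ℝ))) :=
    hprod.integral_prod_left
  refine ⟨(integrableOn_congr_fun hM measurableSet_Ioi).1 (hint.im.div_const π), ?_⟩
  rw [← setIntegral_congr_fun measurableSet_Ioi hM, integral_div]
  have him : ∫ x in Ioi (0 : ℝ), (∫ u in Ioi (0 : ℝ), F x u).im =
      (∫ x in Ioi (0 : ℝ), ∫ u in Ioi (0 : ℝ), F x u).im := integral_im hint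
  rw [him, integral_integral_swap hprod, setIntegral_congr_fun measurableSet_Ioi hFx,
    integral_const_mul, hw, integral_rpow_mul_cexp_sub_one hb0 hb1 hθ]
  have he : (Real.Gamma (p + 1) : ℂ) * Complex.exp (-(α * p : ℝ) * Complex.I) *
      -((Real.Gamma (1 - ν * p) / (ν * p) : ℝ) * Complex.exp ((θ * (ν * p) : ℝ) * Complex.I)) =
      ((-(Real.Gamma (p + 1) * (Real.Gamma (1 - ν * p) / (ν * p))) : ℝ) : ℂ) *
        Complex.exp ((-(π * (ν * p)) : ℝ) * Complex.I) := by
    have : Complex.exp ((-(π * (ν * p)) : ℝ) * Complex.I) =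
        Complex.exp (-(α * p : ℝ) * Complex.I) * Complex.exp ((θ * (ν * p) : ℝ) * Complex.I) := by
      rw [← Complex.exp_add, hα]
      push_cast
      ring_nf
    rw [this]
    push_cast
    ring
  rw [he, Complex.im_ofReal_mul, Complex.exp_ofReal_mul_I_im, Real.sin_neg]
  have hs : 0 < Real.sin (π * (ν * p)) :=
    Real.sin_pos_of_pos_of_lt_pi (by positivity) (by nlinarith [Real.pi_pos])
  have hR := Real.Gamma_mul_Gamma_one_sub (ν * p)
  rw [eq_div_iff hs.ne'] at hR
  have hG := (Real.Gamma_pos_of_pos hb0).ne'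
  have hb := hb0.ne'
  rw [add_comm 1, Real.Gamma_add_one hb]
  generalize ν * p = b at hR hG hb ⊢
  rw [div_eq_div_iff Real.pi_ne_zero (mul_ne_zero hb hG)]
  have hcancel : Real.Gamma (1 - b) / b * b = Real.Gamma (1 - b) := div_mul_cancel₀ _ hb
  linear_combination Real.Gamma (p + 1) * hR +
    Real.Gamma (p + 1) * Real.sin (π * b) * Real.Gamma b * hcancel

lemma integral_mainardi {ν : ℝ} (hν0 : 0 < ν) (hν1 : ν < 1) :
    IntegrableOn (mainardi ν) (Ioi 0) ∧ ∫ x in Ioi (0 : ℝ), mainardi ν x = 1 := by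
  obtain ⟨θ, α, hθ, hα', hα⟩ := exists_ray_angles hν0 hν1
  have h1 := (integral_mellin_mainardi hν0 hν1 one_pos le_rfl).1
  simp only [Real.rpow_one] at h1
  have hmeas : AEStronglyMeasurable (mainardi ν) (volume.restrict (Ioi 0)) := by
    refine ((by fun_prop : AEStronglyMeasurable (fun x : ℝ => x⁻¹) _).mul
      h1.aestronglyMeasurable).congr ?_
    refine (ae_restrict_iff' measurableSet_Ioi).2 (.of_forall fun x hx => ?_)
    exact inv_mul_cancel_left₀ (ne_of_gt hx) _
  have hint : IntegrableOn (mainardi ν) (Ioi 0) := by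
    rw [← Ioc_union_Ioi_eq_Ioi zero_le_one] at hmeas h1 ⊢
    refine IntegrableOn.union ?_ ?_
    · refine (integrableOn_const (C := (∫ u in Ioi (0 : ℝ),
        u ^ (ν - 1) * rexp (-Real.cos θ * u)) / π) (by simp)).mono'
        (hmeas.mono_measure (Measure.restrict_mono subset_union_left le_rfl)) ?_
      refine (ae_restrict_iff' measurableSet_Ioc).2 (.of_forall fun x hx => ?_)
      rw [mainardi_eq_im_integral_s9 hν0 hν1 hθ hα, norm_div, Real.norm_of_nonneg Real.pi_pos.le]
      gcongr
      exact (Complex.abs_im_le_norm _).trans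
        (integrableOn_mainardiKernel hν0 (Real.cos_pos_of_mem_Ioo (abs_lt.1 hθ))
          (Real.cos_pos_of_mem_Ioo (abs_lt.1 hα')) hx.1.le).2
    · refine h1.right_of_union.norm.mono'
        (hmeas.mono_measure (Measure.restrict_mono subset_union_right le_rfl)) ?_
      refine (ae_restrict_iff' measurableSet_Ioi).2 (.of_forall fun x hx => ?_)
      have hx' : 1 < x := hx
      rw [norm_mul, Real.norm_of_nonneg (zero_le_one.trans hx'.le)]
      exact le_mul_of_one_le_left (norm_nonneg _) hx'.le
  refine ⟨hint, ?_⟩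
  have hlim : Tendsto (fun p : ℝ => ∫ x in Ioi (0 : ℝ), x ^ p * mainardi ν x) (𝓝[>] 0)
      (𝓝 (∫ x in Ioi (0 : ℝ), mainardi ν x)) := by
    refine tendsto_integral_filter_of_dominated_convergence
      (fun x => ‖mainardi ν x‖ + ‖x * mainardi ν x‖)
      (.of_forall fun p => (by fun_prop : AEStronglyMeasurable (fun x : ℝ => x ^ p) _).mul hmeas)
      ?_ (hint.norm.add h1.norm) ?_
    · filter_upwards [Ioc_mem_nhdsGT one_pos] with p hp
      refine (ae_restrict_iff' measurableSet_Ioi).2 (.of_forall fun x hx => ?_)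
      have hx' : 0 < x := hx
      have hle : x ^ p ≤ 1 + x := by
        rcases le_total x 1 with h | h
        · linarith [Real.rpow_le_one hx'.le h hp.1.le]
        · have := Real.rpow_le_rpow_of_exponent_le h hp.2
          rw [Real.rpow_one] at this
          linarith
      rw [norm_mul, norm_mul, Real.norm_of_nonneg (rpow_nonneg hx'.le _),
        Real.norm_of_nonneg hx'.le]
      nlinarith [mul_le_mul_of_nonneg_right hle (norm_nonneg (mainardi ν x))]
    · refine (ae_restrict_iff' measurableSet_Ioi).2 (.of_forall fun x hx => ?_)
      have h : ContinuousAt (fun p : ℝ => x ^ p * mainardi ν x) 0 :=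
        (Real.continuousAt_const_rpow (ne_of_gt hx)).mul continuousAt_const
      have h' := h.tendsto
      simp only [Real.rpow_zero, one_mul] at h'
      exact tendsto_nhdsWithin_of_tendsto_nhds h'
  have hlim' : Tendsto (fun p : ℝ => ∫ x in Ioi (0 : ℝ), x ^ p * mainardi ν x) (𝓝[>] 0)
      (𝓝 1) := by
    have hΓ : ContinuousAt Real.Gamma 1 := (Real.differentiableAt_Gamma fun m => by
      have : (0 : ℝ) ≤ m := m.cast_nonneg
      linarith).continuousAt
    have h : ContinuousAt (fun p : ℝ => Real.Gamma (p + 1) / Real.Gamma (1 + ν * p)) 0 :=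
      ContinuousAt.div
        (ContinuousAt.comp (g := Real.Gamma) (f := fun p : ℝ => p + 1) (by simpa using hΓ)
          (by fun_prop))
        (ContinuousAt.comp (g := Real.Gamma) (f := fun p : ℝ => 1 + ν * p) (by simpa using hΓ)
          (by fun_prop)) (by simp)
    have h' := h.tendsto
    simp only [zero_add, mul_zero, add_zero, Real.Gamma_one, div_one] at h'
    refine (tendsto_nhdsWithin_of_tendsto_nhds h').congr' ?_
    filter_upwards [Ioc_mem_nhdsGT one_pos] with p hp
    exact (integral_mellin_mainardi hν0 hν1 hp.1 hp.2).2.symm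
  exact tendsto_nhds_unique hlim hlim'

theorem greenCauchy_center_of_gravity (ν : ℝ) (hν0 : 0 < ν) (hν1 : ν < 1)
    (t : ℝ) (ht : 0 < t) :
    IntegrableOn (fun r : ℝ => r * greenCauchy ν r t) (Ioi 0) ∧
    IntegrableOn (fun r : ℝ => greenCauchy ν r t) (Ioi 0) ∧
    (∫ r in Ioi (0 : ℝ), greenCauchy ν r t) = 1 / 2 ∧
    (∫ r in Ioi (0 : ℝ), r * greenCauchy ν r t) / (∫ r in Ioi (0 : ℝ), greenCauchy ν r t) =
      t ^ ν / Real.Gamma (1 + ν) := by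
  have hT : 0 < t ^ ν := Real.rpow_pos_of_pos ht ν
  set T := t ^ ν with hTdef
  obtain ⟨hi0, hI0⟩ := integral_mainardi hν0 hν1
  obtain ⟨hi1, hI1⟩ := integral_mellin_mainardi hν0 hν1 one_pos le_rfl
  simp only [Real.rpow_one, mul_one, Real.Gamma_add_one one_ne_zero, Real.Gamma_one] at hi1 hI1
  have e0 : ∀ r ∈ Ioi (0 : ℝ), greenCauchy ν r t = (2 * T)⁻¹ * mainardi ν (T⁻¹ * r) :=
    fun r hr => by
      rw [greenCauchy, abs_of_pos hr, ← hTdef, div_eq_inv_mul, div_eq_inv_mul]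
  have e1 : ∀ r ∈ Ioi (0 : ℝ),
      r * greenCauchy ν r t = 2⁻¹ * ((T⁻¹ * r) * mainardi ν (T⁻¹ * r)) := fun r hr => by
    rw [e0 r hr]
    field_simp
  have hT' := inv_pos.2 hT
  have hG0 : (∫ r in Ioi (0 : ℝ), greenCauchy ν r t) = 1 / 2 := by
    rw [setIntegral_congr_fun measurableSet_Ioi e0, integral_const_mul,
      integral_comp_mul_left_Ioi _ _ hT', mul_zero, hI0, inv_inv, smul_eq_mul]
    field_simp
  refine ⟨?_, ?_, hG0, ?_⟩
  · rw [integrableOn_congr_fun e1 measurableSet_Ioi]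
    refine Integrable.const_mul ?_ _
    exact (integrableOn_Ioi_comp_mul_left_iff (fun x => x * mainardi ν x) 0 hT').2 (by simpa using hi1)
  · rw [integrableOn_congr_fun e0 measurableSet_Ioi]
    refine Integrable.const_mul ?_ _
    exact (integrableOn_Ioi_comp_mul_left_iff (mainardi ν) 0 hT').2 (by simpa using hi0)
  · rw [hG0, setIntegral_congr_fun measurableSet_Ioi e1, integral_const_mul,
      integral_comp_mul_left_Ioi (fun x => x * mainardi ν x) _ hT', mul_zero, hI1, inv_inv,
      smul_eq_mul]
    field_simp
end
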